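/- Let A be an n×n symmetric integer matrix with rank_off(A) = 2, where B = [[a_{1,3},a_{1,4}],[a_{2,3},a_{2,4}]] has rank 2, the matrix B₁ (columns (a_{1,j},a_{2,j})ᵀ for j = 3, 5, 6, …, n) has rank 2, and B₂ (columns (a_{1,j},a_{2,j})ᵀ for j = 4, 5, …, n) has rank 1. Then A can be written in block form A = [[A₁, γ₁, γ₂ξᵀ],[γ₁ᵀ, a, vᵀ],[ξγ₂ᵀ, v, D + h·ξξᵀ]] where A₁ is a symmetric 2×2 integer matrix, γ₁ ∈ ℤ², γ₂ ∈ ℚ², the 2×2 matrix (γ₁, γ₂) is invertible over ℚ, ξ, v ∈ ℤ^{n−3}, a ∈ ℤ, h ∈ ℚ, and D = diag(d₁,…,d_{n−3}) is a rational diagonal matrix. -/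

import Mathlib

open Matrix

/-- A square matrix of full rank over a field has nonzero determinant. -/
lemma det_ne_zero_of_rank_eq_card {K n : Type*} [Field K] [Fintype n] [DecidableEq n]
    {M : Matrix n n K} (h : M.rank = Fintype.card n) : M.det ≠ 0 := by
  have htop : LinearMap.range M.mulVecLin = ⊤ :=
    Submodule.eq_top_of_finrank_eq (by rw [Module.finrank_pi]; exact h)
  have hunit : IsUnit M :=
    Matrix.mulVec_surjective_iff_isUnit.1 (LinearMap.range_eq_top.1 htop)
  exact ((Matrix.isUnit_iff_isUnit_det M).1 hunit).ne_zero

/-- Minors larger than the rank vanish. -/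
lemma det_submatrix_eq_zero_of_rank_lt {K m n ι : Type*} [Field K] [Fintype n]
    [Fintype ι] [DecidableEq ι] {M : Matrix m n K} (h : M.rank < Fintype.card ι)
    (r : ι → m) (c : ι → n) : (M.submatrix r c).det = 0 := by
  by_contra hdet
  have := M.rank_submatrix_le r c
  rw [Matrix.rank_of_det_ne_zero hdet] at this
  omega

/-- If the off-diagonal entries of a symmetric matrix satisfy `ξ j * M i k = ξ k * M i j` and `ξ`
has two nonzero entries, then `M` is a multiple of `ξ ξᵀ` off the diagonal. -/
lemma exists_offDiag_eq_smul_mul {K ι : Type*} [Field K] {M : Matrix ι ι K} (hM : M.IsSymm)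
    {ξ : ι → K} (hprop : ∀ i j k, i ≠ j → i ≠ k → ξ j * M i k = ξ k * M i j)
    {s t : ι} (hst : s ≠ t) (hs : ξ s ≠ 0) (ht : ξ t ≠ 0) :
    ∃ h : K, ∀ i j, i ≠ j → M i j = h * ξ i * ξ j := by
  refine ⟨M s t / (ξ s * ξ t), ?_⟩
  have hrow : ∀ j, s ≠ j → M s j = M s t / (ξ s * ξ t) * ξ s * ξ j := by
    intro j hj
    have := hprop s j t hj hst
    field_simp
    linear_combination -this
  intro i j hij
  by_cases hi : s = i
  · subst hi
    exact hrow j hij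
  · have h₁ := hprop i j s hij (Ne.symm hi)
    rw [hM.apply s i, hrow i hi] at h₁
    apply mul_left_cancel₀ hs
    linear_combination -h₁

/-- Lemma 4.10 (structure lemma for the mixed case rank(B₁)=2, rank(B₂)=1):
A symmetric integer n×n matrix with off-diagonal rank 2, rank(B)=2, rank(B₁)=2
and rank(B₂)=1 has block form
[[A₁, γ₁, γ₂ξᵀ],[γ₁ᵀ, a, vᵀ],[ξγ₂ᵀ, v, D + h ξξᵀ]] with (γ₁,γ₂) invertible over ℚ. -/
theorem stmt_8 (m : ℕ) (A : Matrix (Fin (m + 5)) (Fin (m + 5)) ℤ)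
    (hsym : A.IsSymm)
    (hoff : ∀ (k l : ℕ) (f : Fin k → Fin (m + 5)) (g : Fin l → Fin (m + 5)),
      (∀ i j, f i ≠ g j) → ((A.submatrix f g).map ((↑) : ℤ → ℚ)).rank ≤ 2)
    (hB : ((A.map ((↑) : ℤ → ℚ)).submatrix
        (fun i : Fin 2 => (Fin.castLE (by omega) i : Fin (m + 5)))
        (fun j : Fin 2 => (⟨j.val + 2, by omega⟩ : Fin (m + 5)))).rank = 2)
    (hB1 : ((A.map ((↑) : ℤ → ℚ)).submatrix
        (fun i : Fin 2 => (Fin.castLE (by omega) i : Fin (m + 5)))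
        (fun j : Fin (m + 2) => if j.val = 0 then (⟨2, by omega⟩ : Fin (m + 5))
          else ⟨j.val + 3, by omega⟩)).rank = 2)
    (hB2 : ((A.map ((↑) : ℤ → ℚ)).submatrix
        (fun i : Fin 2 => (Fin.castLE (by omega) i : Fin (m + 5)))
        (fun j : Fin (m + 2) => (⟨j.val + 3, by omega⟩ : Fin (m + 5)))).rank = 1) :
    ∃ (γ₁ : Fin 2 → ℤ) (γ₂ : Fin 2 → ℚ) (ξ v : Fin (m + 2) → ℤ) (a : ℤ) (h : ℚ)
      (d : Fin (m + 2) → ℚ),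
      (Matrix.of fun i (k : Fin 2) => if k = 0 then (γ₁ i : ℚ) else γ₂ i).det ≠ 0 ∧
      (∀ i : Fin 2, A (Fin.castLE (by omega) i) ⟨2, by omega⟩ = γ₁ i) ∧
      A ⟨2, by omega⟩ ⟨2, by omega⟩ = a ∧
      (∀ (i : Fin 2) (j : Fin (m + 2)),
        (A (Fin.castLE (by omega) i) ⟨j.val + 3, by omega⟩ : ℚ) = γ₂ i * (ξ j : ℚ)) ∧
      (∀ j : Fin (m + 2), A ⟨2, by omega⟩ ⟨j.val + 3, by omega⟩ = v j) ∧
      (∀ i j : Fin (m + 2), (A ⟨i.val + 3, by omega⟩ ⟨j.val + 3, by omega⟩ : ℚ)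
          = (if i = j then d i else 0) + h * (ξ i : ℚ) * (ξ j : ℚ)) := by
  let c : Fin 2 → Fin (m + 2) → ℤ := fun i j =>
    A (Fin.castLE (by omega) i) ⟨j.val + 3, by omega⟩
  let g : Fin 2 → ℤ := fun i => A (Fin.castLE (by omega) i) ⟨2, by omega⟩
  let w : Fin (m + 2) → ℤ := fun i => A ⟨i.val + 3, by omega⟩ ⟨2, by omega⟩
  let M : Matrix (Fin (m + 2)) (Fin (m + 2)) ℚ := fun i j =>
    (A ⟨i.val + 3, by omega⟩ ⟨j.val + 3, by omega⟩ : ℚ)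
  have hM : M.IsSymm := Matrix.IsSymm.ext fun i j => congrArg (Int.cast : ℤ → ℚ) (hsym.apply _ _)
  have hdet : (g 0 : ℚ) * c 1 0 - c 0 0 * g 1 ≠ 0 := by
    have := det_ne_zero_of_rank_eq_card (hB.trans (Fintype.card_fin 2).symm)
    rw [Matrix.det_fin_two] at this
    exact this
  have hminor : ∀ r s i j, (c r i : ℚ) * c s j = c r j * c s i := by
    intro r s i j
    have := det_submatrix_eq_zero_of_rank_lt (ι := Fin 2) (by rw [hB2]; simp) ![r, s] ![i, j]
    rw [Matrix.det_fin_two] at this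
    exact sub_eq_zero.1 this
  have hnonzero : ∃ t, (0 : Fin (m + 2)) ≠ t ∧ ∃ s, c s t ≠ 0 := by
    by_contra! hzero
    have hle := Matrix.rank_vecMulVec_le (fun i => (g i : ℚ)) (Pi.single (0 : Fin (m + 2)) 1)
    refine absurd hle (not_le.2 (lt_of_lt_of_eq one_lt_two (hB1.symm.trans ?_)))
    congr 1
    ext i j
    by_cases hj : j = 0
    · subst hj
      simp [Matrix.vecMulVec_apply, g]
    · have hj' : j.val ≠ 0 := fun h => hj (Fin.ext h)
      have := hzero j (Ne.symm hj) i
      simp only [c] at this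
      simp [Matrix.vecMulVec_apply, hj, this]
  have hthree : ∀ i j k, i ≠ j → i ≠ k →
      (g 0 : ℚ) * c 1 j * M i k - g 0 * c 1 k * M i j - c 0 j * g 1 * M i k
        + c 0 j * c 1 k * w i + c 0 k * g 1 * M i j - c 0 k * c 1 j * w i = 0 := by
    intro i j k hij hik
    have hrank := hoff 3 3 ![⟨0, by omega⟩, ⟨1, by omega⟩, ⟨i.val + 3, by omega⟩]
      ![⟨2, by omega⟩, ⟨j.val + 3, by omega⟩, ⟨k.val + 3, by omega⟩] (by
        rw [Ne, Fin.ext_iff] at hij hik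
        intro a b
        fin_cases a <;> fin_cases b <;> rw [Ne, Fin.ext_iff] <;> simp <;> omega)
    have := det_submatrix_eq_zero_of_rank_lt (ι := Fin 3)
      (lt_of_le_of_lt hrank (by simp)) id id
    rw [Matrix.det_fin_three] at this
    exact this
  obtain ⟨r, hr⟩ : ∃ r, (c r 0 : ℚ) ≠ 0 := by
    by_contra! hzero
    exact hdet (by rw [hzero 0, hzero 1]; ring)
  obtain ⟨t, h0t, s, hs⟩ := hnonzero
  have ht : (c r t : ℚ) ≠ 0 := by
    intro h
    have := hminor s r t 0
    rw [h, mul_zero] at this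
    exact mul_ne_zero (Int.cast_ne_zero.2 hs) hr this
  have hprop : ∀ i j k, i ≠ j → i ≠ k → (c r j : ℚ) * M i k = c r k * M i j := by
    intro i j k hij hik
    apply mul_left_cancel₀ hdet
    linear_combination (c r 0 : ℚ) * hthree i j k hij hik
      + (g 0 * M i k) * hminor 1 r 0 j - (g 0 * M i j) * hminor 1 r 0 k
      - (g 1 * M i k) * hminor 0 r 0 j + (g 1 * M i j) * hminor 0 r 0 k
      - c r 0 * w i * hminor 0 1 j k
  obtain ⟨h, hh⟩ := exists_offDiag_eq_smul_mul hM hprop h0t hr ht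
  refine ⟨g, fun i => c i 0 / c r 0, c r, fun j => A ⟨2, by omega⟩ ⟨j.val + 3, by omega⟩, _, h,
    fun i => M i i - h * c r i * c r i, ?_, fun _ => rfl, rfl, ?_, fun _ => rfl, ?_⟩
  · rw [Matrix.det_fin_two]
    intro h
    apply hdet
    simp only [Matrix.of_apply, if_true, one_ne_zero, if_false] at h
    field_simp at h
    linear_combination h
  · intro i j
    change (c i j : ℚ) = _
    have := hminor i r j 0
    field_simp
    linear_combination this
  · intro i j
    change M i j = _
    by_cases hij : i = j
    · subst hij
      simp
    · simp [hij, hh i j hij]
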